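/- Let Γ be a labelled graph with no cone points, i.e., for every vertex t there exists a vertex v ≠ t with m(t,v) = ∞. Then the Artin group A_Γ has trivial center. -/

import Mathlib

/-- A labelled graph: a vertex set `V` and a symmetric labelling `m : V → V → ℕ∞`
with `m u v ≥ 2` for `u ≠ v` (`m u v = ∞` means no edge). -/
structure LabelledGraph (V : Type*) where
  m : V → V → ℕ∞
  symm : ∀ u v, m u v = m v u
  two_le : ∀ u v, u ≠ v → 2 ≤ m u v

namespace LabelledGraph

variable {V W : Type*}

/-- The alternating product `x * y * x * ⋯` with `n` terms. -/
def altProd {G : Type*} [Monoid G] (x y : G) : ℕ → G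
  | 0 => 1
  | n + 1 => x * altProd y x n

/-- The alternating word `u v u v ⋯` with `n` terms in the free group. -/
def altWord (u v : V) (n : ℕ) : FreeGroup V :=
  altProd (FreeGroup.of u) (FreeGroup.of v) n

/-- The Artin relations of a labelled graph: for each `u ≠ v` with finite label
`m u v = k`, the relation `(u v u ⋯) = (v u v ⋯)` (both sides with `k` terms). -/
def artinRels (Γ : LabelledGraph V) : Set (FreeGroup V) :=
  { r | ∃ (u v : V) (k : ℕ), u ≠ v ∧ Γ.m u v = (k : ℕ∞) ∧
        r = altWord u v k * (altWord v u k)⁻¹ }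

/-- The Artin group of a labelled graph. -/
abbrev ArtinGroup (Γ : LabelledGraph V) : Type _ := PresentedGroup Γ.artinRels

/-- The standard generators of an Artin group. -/
def σ (Γ : LabelledGraph V) (v : V) : Γ.ArtinGroup := PresentedGroup.of v

/-- The special subgroup of the Artin group generated by `{σ v : v ∈ K}`. -/
def specialSubgroup (Γ : LabelledGraph V) (K : Set V) : Subgroup Γ.ArtinGroup :=
  Subgroup.closure (Γ.σ '' K)

/-- A cone point of `Γ`: a vertex `t` with `m t v < ∞` for every `v ≠ t`. -/
def IsConePoint (Γ : LabelledGraph V) (t : V) : Prop :=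
  ∀ v : V, v ≠ t → Γ.m t v ≠ ⊤

/-- The induced labelled subgraph on a subset `K` of the vertices. -/
def induce (Γ : LabelledGraph V) (K : Set V) : LabelledGraph K where
  m u v := Γ.m u v
  symm u v := Γ.symm u v
  two_le u v h := Γ.two_le u v (fun e => h (Subtype.ext e))

/-- `Γ` is irreducible if its vertex set admits no partition into two nonempty sets
with all labels between the two parts equal to `2`. -/
def Irreducible (Γ : LabelledGraph V) : Prop :=
  ¬ ∃ V₁ V₂ : Set V, V₁.Nonempty ∧ V₂.Nonempty ∧ Disjoint V₁ V₂ ∧ V₁ ∪ V₂ = Set.univ ∧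
      ∀ u ∈ V₁, ∀ v ∈ V₂, Γ.m u v = 2

/-- The square relations `σ_v² = 1` defining the Coxeter quotient. -/
def squareRels (V : Type*) : Set (FreeGroup V) :=
  Set.range fun v : V => FreeGroup.of v * FreeGroup.of v

/-- The Coxeter group of a labelled graph: the quotient of the Artin group obtained
by adding the relations `σ_v² = 1`. -/
abbrev CoxeterGroupOf (Γ : LabelledGraph V) : Type _ :=
  PresentedGroup (Γ.artinRels ∪ squareRels V)

/-- `Γ` is spherical if its Coxeter group is finite. -/
def Spherical (Γ : LabelledGraph V) : Prop := Finite Γ.CoxeterGroupOf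

/-- The natural surjection `θ` from the Artin group to the Coxeter group. -/
def artinToCoxeter (Γ : LabelledGraph V) : Γ.ArtinGroup →* Γ.CoxeterGroupOf :=
  QuotientGroup.map _ _ (MonoidHom.id _)
    (by
      intro x hx
      simpa using Subgroup.normalClosure_mono (Set.subset_union_left (t := squareRels V)) hx)

/-- The pure Artin group: the kernel of the natural surjection to the Coxeter group. -/
def pureArtinGroup (Γ : LabelledGraph V) : Subgroup Γ.ArtinGroup :=
  (artinToCoxeter Γ).ker

/-- `P : Fin n → Set V` is a decomposition of `Γ` as a `2`-labelled join of
irreducible induced subgraphs. -/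
def IsIrredDecomp (Γ : LabelledGraph V) (n : ℕ) (P : Fin n → Set V) : Prop :=
  (∀ i, (P i).Nonempty) ∧
  (⋃ i, P i) = Set.univ ∧
  (∀ i j, i ≠ j → Disjoint (P i) (P j)) ∧
  (∀ i j, i ≠ j → ∀ u ∈ P i, ∀ v ∈ P j, Γ.m u v = 2) ∧
  (∀ i, (Γ.induce (P i)).Irreducible)

/-- `Γ` satisfies the Center Conjecture if for the (finest) decomposition of `Γ` as a
`2`-labelled join of irreducible induced subgraphs `Γ₁, …, Γₙ`, the center of the Artin
group `A_Γ` is free abelian of rank the number of spherical factors `Γᵢ`. -/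
def SatisfiesCenterConjecture (Γ : LabelledGraph V) : Prop :=
  ∀ (n : ℕ) (P : Fin n → Set V), Γ.IsIrredDecomp n P →
    Nonempty ((Subgroup.center Γ.ArtinGroup) ≃*
      Multiplicative (Fin (Nat.card {i : Fin n // (Γ.induce (P i)).Spherical}) → ℤ))

/-- A monoid hom applied to an alternating product. -/
theorem map_altProd {G H : Type*} [Monoid G] [Monoid H] (φ : G →* H) (x y : G) (n : ℕ) :
    φ (altProd x y n) = altProd (φ x) (φ y) n := by
  induction n generalizing x y with
  | zero => simp [altProd]
  | succ n ih => simp [altProd, ih]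

/-- The homomorphism between Artin groups induced by a label-preserving injection of
labelled graphs, sending generators to generators. -/
def mapHom (Γ : LabelledGraph V) (Δ : LabelledGraph W) (f : V → W)
    (hf : ∀ u v : V, u ≠ v → f u ≠ f v)
    (hm : ∀ u v : V, Γ.m u v = Δ.m (f u) (f v)) :
    Γ.ArtinGroup →* Δ.ArtinGroup :=
  PresentedGroup.toGroup (f := fun v => Δ.σ (f v))
    (by
      rintro r ⟨u, v, k, huv, hk, rfl⟩
      have key : ∀ (a b : V),
          FreeGroup.lift (fun v => Δ.σ (f v)) (altWord a b k)
            = PresentedGroup.mk Δ.artinRels (altWord (f a) (f b) k) := by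
        intro a b
        rw [altWord, map_altProd, altWord, map_altProd]
        simp [σ, PresentedGroup.of]
      rw [map_mul, map_inv, key, key, ← map_inv, ← map_mul]
      refine (QuotientGroup.eq_one_iff _).mpr (Subgroup.subset_normalClosure ?_)
      exact ⟨f u, f v, k, hf u v huv, (hm u v) ▸ hk, rfl⟩)

@[simp]
theorem mapHom_σ (Γ : LabelledGraph V) (Δ : LabelledGraph W) (f : V → W)
    (hf : ∀ u v : V, u ≠ v → f u ≠ f v)
    (hm : ∀ u v : V, Γ.m u v = Δ.m (f u) (f v)) (v : V) :
    mapHom Γ Δ f hf hm (Γ.σ v) = Δ.σ (f v) :=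
  PresentedGroup.toGroup.of _

/-- The homomorphism between the Artin groups of induced subgraphs coming from an
inclusion `K' ⊆ K`. -/
def induceHom (Γ : LabelledGraph V) {K' K : Set V} (h : K' ⊆ K) :
    (Γ.induce K').ArtinGroup →* (Γ.induce K).ArtinGroup :=
  mapHom _ _ (Set.inclusion h)
    (fun _ _ huv e => huv (Set.inclusion_injective h e))
    (fun _ _ => rfl)

/-- The homomorphism from the Artin group of an induced subgraph to the ambient
Artin group. -/
def inclHom (Γ : LabelledGraph V) (K : Set V) :
    (Γ.induce K).ArtinGroup →* Γ.ArtinGroup :=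
  mapHom _ _ Subtype.val
    (fun _ _ huv e => huv (Subtype.ext e))
    (fun _ _ => rfl)

end LabelledGraph

namespace CoxeterMatrix

open Real Polynomial Module

variable {B : Type*} (M : CoxeterMatrix B)

/-- The linear form `x ↦ 2 ⟨αᵢ, x⟩` of the geometric representation. -/
noncomputable def simpleCoroot (i : B) : Dual ℝ (B →₀ ℝ) :=
  Finsupp.linearCombination ℝ fun j => -2 * cos (π / M i j)

theorem simpleCoroot_single (i j : B) :
    M.simpleCoroot i (Finsupp.single j 1) = -2 * cos (π / M i j) := by
  simp [simpleCoroot]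

theorem simpleCoroot_self (i : B) : M.simpleCoroot i (Finsupp.single i 1) = 2 := by
  simp [simpleCoroot_single]

/-- The simple reflections of the geometric representation. -/
noncomputable def simpleReflection (i : B) : (B →₀ ℝ) ≃ₗ[ℝ] (B →₀ ℝ) :=
  reflection (M.simpleCoroot_self i)

theorem coroot_mul_coroot_sub_two (i j : B) :
    M.simpleCoroot i (Finsupp.single j 1) * M.simpleCoroot j (Finsupp.single i 1) - 2
      = 2 * cos (2 * (π / M i j)) := by
  rw [simpleCoroot_single, simpleCoroot_single, M.symmetric j i, cos_two_mul]
  ring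

theorem three_le_of_ne {i j : B} (hij : i ≠ j) (h0 : M i j ≠ 0) (h2 : M i j ≠ 2) :
    3 ≤ M i j := by
  have := M.off_diagonal i j hij
  omega

theorem sin_two_mul_pi_div_pos {m : ℕ} (hm : 3 ≤ m) : 0 < sin (2 * (π / m)) := by
  have h3 : (3 : ℝ) ≤ m := by exact_mod_cast hm
  refine sin_pos_of_pos_of_lt_pi (by positivity) ?_
  rw [← mul_div_assoc, div_lt_iff₀ (by positivity)]
  nlinarith [pi_pos]

theorem eval_S_add_eval_S {φ : ℝ} (hφ : sin φ ≠ 0) (n : ℤ) :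
    (Chebyshev.S ℝ n).eval (2 * cos φ) + (Chebyshev.S ℝ (n - 1)).eval (2 * cos φ)
      = (sin ((n + 1) * φ) + sin (n * φ)) / sin φ := by
  rw [eq_div_iff hφ, add_mul, Chebyshev.S_two_mul_real_cos, Chebyshev.S_two_mul_real_cos]
  push_cast
  ring_nf

theorem eval_S_eq {φ : ℝ} (hφ : sin φ ≠ 0) (n : ℤ) :
    (Chebyshev.S ℝ n).eval (2 * cos φ) = sin ((n + 1) * φ) / sin φ := by
  rw [eq_div_iff hφ, Chebyshev.S_two_mul_real_cos]

theorem isLiftable_simpleReflection : M.IsLiftable M.simpleReflection := by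
  intro i j
  by_cases hij : i = j
  · subst hij
    rw [M.diagonal, pow_one]
    refine LinearEquiv.ext fun z => ?_
    exact involutive_reflection (M.simpleCoroot_self i) z
  by_cases h0 : M i j = 0
  · rw [h0, pow_zero]
  have hm0 : (M i j : ℝ) ≠ 0 := by exact_mod_cast h0
  apply LinearEquiv.ext
  intro z
  rw [simpleReflection, simpleReflection, reflection_mul_reflection_pow_apply _ _ _ _ _
    (M.coroot_mul_coroot_sub_two i j).symm]
  by_cases h2 : M i j = 2
  · have hc : cos (π / (2 : ℕ)) = 0 := by simp
    have hc' : cos (2 * (π / (2 : ℕ))) = -1 := by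
      rw [show 2 * (π / (2 : ℕ)) = π by push_cast; ring, cos_pi]
    rw [M.simpleCoroot_single, M.simpleCoroot_single, M.symmetric j i, h2, hc, hc']
    norm_num
    module
  have h3 := M.three_le_of_ne hij h0 h2
  have hs := (sin_two_mul_pi_div_pos h3).ne'
  obtain ⟨k, hk⟩ | ⟨k, hk⟩ := Nat.even_or_odd (M i j)
  · have e1 : ((M i j : ℤ) - 2) / 2 = k - 1 := by omega
    have e2 : ((M i j : ℤ) - 1) / 2 = k - 1 := by omega
    have key : sin ((((k - 1 : ℤ) : ℝ) + 1) * (2 * (π / M i j))) = 0 := by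
      have : (((k - 1 : ℤ) : ℝ) + 1) * (2 * (π / M i j)) = π := by
        have : (M i j : ℝ) = 2 * k := by rw [two_mul]; exact_mod_cast hk
        have hk0 : (k : ℝ) ≠ 0 := by
          rintro h
          simp [this, h] at hm0
        rw [this]
        push_cast
        field_simp
        ring
      rw [this, sin_pi]
    rw [e1, e2, eval_S_eq hs (k - 1), key]
    simp
  · have e1 : ((M i j : ℤ) - 2) / 2 = k - 1 := by omega
    have e2 : ((M i j : ℤ) - 1) / 2 = k := by omega
    have e3 : ((M i j : ℤ) - 3) / 2 = k - 1 := by omega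
    have e4 : (M i j : ℤ) / 2 = k := by omega
    have key : sin (((k : ℤ) + 1 : ℝ) * (2 * (π / M i j))) + sin ((k : ℤ) * (2 * (π / M i j)))
        = 0 := by
      have hm : (M i j : ℝ) = 2 * k + 1 := by exact_mod_cast hk
      have : ((k : ℤ) + 1 : ℝ) * (2 * (π / M i j)) = 2 * π - (k : ℤ) * (2 * (π / M i j)) := by
        rw [hm] at hm0 ⊢
        push_cast
        field_simp
        ring
      rw [this, sin_two_pi_sub]
      ring
    rw [e1, e2, e3, e4, eval_S_add_eval_S hs, key]
    simp

theorem simpleReflection_mul_pow_eq_one {i j : B} {n : ℕ}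
    (h : (M.simpleReflection i * M.simpleReflection j) ^ n = 1) : M i j ∣ n := by
  by_cases hij : i = j
  · subst hij
    simp
  have hx := congrArg (fun e : (B →₀ ℝ) ≃ₗ[ℝ] (B →₀ ℝ) => e (Finsupp.single i 1)) h
  simp only [simpleReflection] at hx
  rw [reflection_mul_reflection_pow_apply_self _ _ _ _
    (M.coroot_mul_coroot_sub_two i j).symm] at hx
  have hxi := DFunLike.congr_fun hx i
  have hxj := DFunLike.congr_fun hx j
  simp [hij, Ne.symm hij, M.simpleCoroot_single] at hxi hxj
  by_cases h0 : M i j = 0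
  · rw [M.symmetric j i, h0] at hxj
    simpa [h0] using hxj
  by_cases h2 : M i j = 2
  · have hc' : cos (2 * (π / (2 : ℕ))) = -1 := by
      rw [show 2 * (π / (2 : ℕ)) = π by push_cast; ring, cos_pi]
    rw [h2, hc', mul_neg_one, Chebyshev.S_eval_neg_two, Chebyshev.S_eval_neg_two,
      Int.negOnePow_sub] at hxi
    rw [h2]
    rcases Nat.even_or_odd n with he | ho
    · exact he.two_dvd
    · rw [Int.negOnePow_odd _ (by exact_mod_cast ho)] at hxi
      norm_num at hxi
  have h3 := M.three_le_of_ne hij h0 h2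
  have hs := (sin_two_mul_pi_div_pos h3)
  have hm0 : (M i j : ℝ) ≠ 0 := by exact_mod_cast h0
  have hcos : cos (π / M j i) ≠ 0 := by
    intro hc
    rw [M.symmetric j i] at hc
    rw [sin_two_mul, hc] at hs
    simp at hs
  rw [eval_S_eq hs.ne'] at hxj
  have hsin : sin (n * (2 * (π / M i j))) = 0 := by simpa [hs.ne', hcos] using hxj
  have hcosn : cos (n * (2 * (π / M i j))) = 1 := by
    have := eval_S_add_eval_S hs.ne' n
    rw [hxi, Int.cast_natCast, hsin, add_mul, sin_add, hsin] at this
    simpa [hs.ne'] using this.symm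
  obtain ⟨l, hl⟩ := (cos_eq_one_iff _).1 hcosn
  have : (l * M i j : ℝ) = n := by
    have hpi := pi_pos.ne'
    field_simp at hl
    linarith
  exact Int.natCast_dvd_natCast.1 ⟨l, by rw [mul_comm]; exact_mod_cast this.symm⟩

end CoxeterMatrix

namespace CoxeterSystem

variable {B W : Type*} [Group W] {M : CoxeterMatrix B} (cs : CoxeterSystem M W)

theorem orderOf_simple_mul_simple (i j : B) : orderOf (cs.simple i * cs.simple j) = M i j := by
  refine Nat.dvd_antisymm (orderOf_dvd_of_pow_eq_one (cs.simple_mul_simple_pow i j)) ?_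
  apply M.simpleReflection_mul_pow_eq_one
  have h := congrArg (cs.lift ⟨_, M.isLiftable_simpleReflection⟩)
    (pow_orderOf_eq_one (cs.simple i * cs.simple j))
  simpa only [map_pow, map_mul, cs.lift_apply_simple, map_one] using h

theorem simple_injective : Function.Injective cs.simple := by
  intro i j h
  by_contra hij
  have := cs.orderOf_simple_mul_simple i j
  rw [h, cs.simple_mul_simple_self, orderOf_one] at this
  exact M.off_diagonal i j hij this.symm

open Classical in
/-- The action of a simple generator on signed group elements: conjugation, with a change of sign
exactly at that generator. -/
noncomputable def signedConj (i : B) : Equiv.Perm (W × ℤˣ) :=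
  Function.Involutive.toPerm
    (fun x => (cs.simple i * x.1 * cs.simple i, x.2 * if x.1 = cs.simple i then -1 else 1)) <| by
      rintro ⟨p, ε⟩
      by_cases hp : p = cs.simple i
      · simp [hp]
      · have : p * cs.simple i ≠ 1 := fun h => hp <| by
          rw [eq_inv_of_mul_eq_one_left h, cs.inv_simple]
        simp [hp, this, mul_assoc]

open Classical in
theorem signedConj_apply (i : B) (x : W × ℤˣ) :
    cs.signedConj i x
      = (cs.simple i * x.1 * cs.simple i, x.2 * if x.1 = cs.simple i then -1 else 1) := rfl

theorem simple_mul_pow_mul_simple (i j : B) (n : ℕ) :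
    cs.simple j * (cs.simple i * cs.simple j) ^ n * cs.simple j
      = ((cs.simple i * cs.simple j) ^ n)⁻¹ := by
  have h := conj_pow (i := n) (a := cs.simple j) (b := cs.simple i * cs.simple j)
  rw [cs.inv_simple] at h
  rw [← h, ← inv_pow]
  simp [mul_assoc]

open Classical in
theorem signedConj_mul_pow (i j : B) (n : ℕ) (p : W) (ε : ℤˣ) :
    ((cs.signedConj i * cs.signedConj j) ^ n) (p, ε)
      = ((cs.simple i * cs.simple j) ^ n * p * ((cs.simple i * cs.simple j) ^ n)⁻¹,
        ε * ∏ k ∈ Finset.range (2 * n),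
          if p = cs.simple j * (cs.simple i * cs.simple j) ^ k then -1 else 1) := by
  induction n with
  | zero => simp
  | succ n ih =>
    have hj := cs.simple_mul_pow_mul_simple i j n
    set c := cs.simple i * cs.simple j with hc
    have hinv : (c ^ n)⁻¹ * cs.simple j = cs.simple j * c ^ n := by
      rw [← hj]
      simp [mul_assoc]
    have hinv' : (c ^ n)⁻¹ * cs.simple j * c ^ n = cs.simple j * c ^ (2 * n) := by
      rw [hinv, two_mul, pow_add, mul_assoc]
    have h1 : c ^ n * p * (c ^ n)⁻¹ = cs.simple j ↔ p = cs.simple j * c ^ (2 * n) := by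
      rw [← hinv', mul_inv_eq_iff_eq_mul, ← eq_inv_mul_iff_mul_eq, mul_assoc]
    have h2 : cs.simple j * (c ^ n * p * (c ^ n)⁻¹) * cs.simple j = cs.simple i
        ↔ p = cs.simple j * c ^ (2 * n + 1) := by
      have : cs.simple j * c ^ (2 * n + 1)
          = (c ^ n)⁻¹ * (cs.simple j * cs.simple i * cs.simple j) * c ^ n := by
        rw [pow_succ', show cs.simple j * (c * c ^ (2 * n))
          = cs.simple j * cs.simple i * (cs.simple j * c ^ (2 * n)) by rw [hc]; simp only [mul_assoc],
          ← hinv']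
        have hcomm : cs.simple j * cs.simple i * (c ^ n)⁻¹
            = (c ^ n)⁻¹ * (cs.simple j * cs.simple i) := by
          have : cs.simple j * cs.simple i = c⁻¹ := by simp [hc]
          rw [this]
          exact ((Commute.refl c).pow_right n).inv_inv.eq
        simp only [← mul_assoc] at hcomm ⊢
        rw [hcomm]
      rw [this]
      constructor
      · intro h
        rw [← h]
        simp [mul_assoc]
      · rintro rfl
        simp [mul_assoc]
    rw [pow_succ', Equiv.Perm.mul_apply, ih, Equiv.Perm.mul_apply, signedConj_apply,
      signedConj_apply, show 2 * (n + 1) = 2 * n + 1 + 1 by ring, Finset.prod_range_succ,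
      Finset.prod_range_succ]
    ext1
    · simp [pow_succ', hc, mul_assoc]
    · simp only [h1, h2]
      simp only [mul_assoc]

theorem isLiftable_signedConj : M.IsLiftable cs.signedConj := by
  classical
  intro i j
  ext1 ⟨p, ε⟩
  rw [signedConj_mul_pow, two_mul, Finset.prod_range_add]
  simp only [pow_add, cs.simple_mul_simple_pow, one_mul, inv_one, mul_one, Int.units_mul_self,
    Equiv.Perm.one_apply]

open Classical in
/-- The sign by which `w` acts on the positive root of a reflection `p`. -/
noncomputable def reflSign (w p : W) : ℤˣ :=
  (cs.lift ⟨_, cs.isLiftable_signedConj⟩ w (p, 1)).2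

theorem lift_signedConj_apply (w p : W) (ε : ℤˣ) :
    cs.lift ⟨_, cs.isLiftable_signedConj⟩ w (p, ε) = (w * p * w⁻¹, ε * cs.reflSign w p) := by
  classical
  suffices h : ∀ p ε, (cs.lift ⟨_, cs.isLiftable_signedConj⟩ w (p, ε)).1 = w * p * w⁻¹ ∧
      (cs.lift ⟨_, cs.isLiftable_signedConj⟩ w (p, ε)).2
        = ε * (cs.lift ⟨_, cs.isLiftable_signedConj⟩ w (p, 1)).2 from
    Prod.ext (h p ε).1 (h p ε).2
  induction w using cs.simple_induction_left with
  | one => simp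
  | mul_simple_left w i ih =>
    intro p ε
    rw [map_mul, cs.lift_apply_simple, Equiv.Perm.mul_apply, Equiv.Perm.mul_apply,
      signedConj_apply, signedConj_apply]
    dsimp only
    rw [(ih p ε).1, (ih p ε).2, (ih p 1).1]
    simp [mul_assoc]

open Classical in
theorem reflSign_simple (i : B) (p : W) :
    cs.reflSign (cs.simple i) p = if p = cs.simple i then -1 else 1 := by
  rw [reflSign, cs.lift_apply_simple, signedConj_apply, one_mul]

theorem reflSign_mul (u v p : W) :
    cs.reflSign (u * v) p = cs.reflSign v p * cs.reflSign u (v * p * v⁻¹) := by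
  rw [reflSign, map_mul, Equiv.Perm.mul_apply, lift_signedConj_apply, lift_signedConj_apply,
    one_mul]

@[simp]
theorem reflSign_one (p : W) : cs.reflSign 1 p = 1 := by
  simp [reflSign]

theorem reflSign_inv_conj (w p : W) : cs.reflSign w⁻¹ (w * p * w⁻¹) = cs.reflSign w p := by
  have h := cs.reflSign_mul w⁻¹ w p
  rw [inv_mul_cancel, reflSign_one] at h
  rw [← Int.units_inv_eq_self (cs.reflSign w p)]
  exact eq_inv_of_mul_eq_one_right h.symm

theorem reflSign_mul_simple (w : W) (i : B) :
    cs.reflSign (w * cs.simple i) (cs.simple i) = -cs.reflSign w (cs.simple i) := by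
  rw [reflSign_mul, reflSign_simple]
  simp

theorem reflSign_simple_of_ne (i : B) {p : W} (hp : p ≠ cs.simple i) :
    cs.reflSign (cs.simple i) p = 1 := by
  rw [reflSign_simple, if_neg hp]

theorem eq_neg_one_of_reflSign_ne_one {ε : ℤˣ} (h : ε ≠ 1) : ε = -1 :=
  (Int.units_eq_one_or ε).resolve_left h

/-- The strong exchange property. -/
theorem exists_sublist_of_reflSign_eq_neg_one (L : List B) (p : W)
    (h : cs.reflSign (cs.wordProd L) p = -1) :
    ∃ L' : List B, L'.Sublist L ∧ L'.length + 1 = L.length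
      ∧ cs.wordProd L * p = cs.wordProd L' := by
  induction L with
  | nil => simp at h
  | cons i L ih =>
    rw [wordProd_cons, reflSign_mul] at h
    by_cases hL : cs.reflSign (cs.wordProd L) p = -1
    · obtain ⟨L', hsub, hlen, hprod⟩ := ih hL
      exact ⟨i :: L', hsub.cons_cons i, by simp [hlen],
        by rw [wordProd_cons, wordProd_cons, mul_assoc, hprod]⟩
    · rw [(Int.units_eq_one_or _).resolve_right hL, one_mul] at h
      by_cases hp : cs.wordProd L * p * (cs.wordProd L)⁻¹ = cs.simple i
      · refine ⟨L, List.sublist_cons_self i L, rfl, ?_⟩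
        rw [wordProd_cons, mul_assoc, mul_inv_eq_iff_eq_mul.1 hp]
        simp
      · rw [cs.reflSign_simple_of_ne i hp] at h
        exact absurd h (by decide)

/-- The standard parabolic subgroup generated by `Y`. -/
def parabolic (Y : Set B) : Subgroup W := Subgroup.closure (cs.simple '' Y)

theorem simple_mem_parabolic {Y : Set B} {y : B} (hy : y ∈ Y) : cs.simple y ∈ cs.parabolic Y :=
  Subgroup.subset_closure ⟨y, hy, rfl⟩

theorem exists_wordProd_eq_of_mem_parabolic {Y : Set B} {d : W} (hd : d ∈ cs.parabolic Y) :
    ∃ L : List B, (∀ y ∈ L, y ∈ Y) ∧ cs.wordProd L = d := by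
  induction hd using Subgroup.closure_induction with
  | mem x hx =>
    obtain ⟨y, hy, rfl⟩ := hx
    exact ⟨[y], by simpa using hy, by simp⟩
  | one => exact ⟨[], by simp, by simp⟩
  | mul x y _ _ hx hy =>
    obtain ⟨L, hL, rfl⟩ := hx
    obtain ⟨L', hL', rfl⟩ := hy
    refine ⟨L ++ L', fun y hy => ?_, cs.wordProd_append L L'⟩
    exact (List.mem_append.1 hy).elim (hL y) (hL' y)
  | inv x _ hx =>
    obtain ⟨L, hL, rfl⟩ := hx
    exact ⟨L.reverse, by simpa using hL, by simp⟩

theorem eq_one_of_mem_parabolic {Y : Set B} {d : W} (hd : d ∈ cs.parabolic Y)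
    (h : ∀ y ∈ Y, cs.reflSign d (cs.simple y) = 1) : d = 1 := by
  obtain ⟨L₀, hL₀, hprod₀⟩ := cs.exists_wordProd_eq_of_mem_parabolic hd
  obtain ⟨L, ⟨hL, rfl⟩, hmin⟩ := (measure List.length).wf.has_min
    {L : List B | (∀ y ∈ L, y ∈ Y) ∧ cs.wordProd L = d} ⟨L₀, hL₀, hprod₀⟩
  rcases L.eq_nil_or_concat' with rfl | ⟨L', y, rfl⟩
  · simp
  have hL' : ∀ z ∈ L', z ∈ Y := fun z hz => hL z (by simp [hz])
  have hsign := h y (hL y (by simp))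
  rw [wordProd_append, wordProd_singleton, reflSign_mul_simple, neg_eq_iff_eq_neg] at hsign
  obtain ⟨L'', hsub, hlen, hprod⟩ := cs.exists_sublist_of_reflSign_eq_neg_one L' _ hsign
  refine absurd ?_ (hmin L'' ⟨fun z hz => hL' z (hsub.subset hz), ?_⟩)
  · change L''.length < (L' ++ [y]).length
    rw [List.length_append]
    lia
  · rw [wordProd_append, wordProd_singleton, hprod]

/-- Every element factors as a minimal representative of a coset of a standard parabolic subgroup
times an element of that subgroup. -/
theorem exists_minimal_mul_parabolic (Y : Set B) (u : W) :
    ∃ u₁, ∃ d ∈ cs.parabolic Y, u = u₁ * d ∧ ∀ p ∈ cs.parabolic Y, cs.reflSign u₁ p = 1 := by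
  obtain ⟨u₁, hu₁, hmin⟩ := (measure cs.length).wf.has_min
    {v : W | v⁻¹ * u ∈ cs.parabolic Y} ⟨u, by simp [one_mem]⟩
  refine ⟨u₁, u₁⁻¹ * u, hu₁, by simp, fun p hp => ?_⟩
  by_contra hsign
  obtain ⟨L, hlen, rfl⟩ := cs.exists_isReduced u₁
  obtain ⟨L', -, hlen', hprod⟩ := cs.exists_sublist_of_reflSign_eq_neg_one L p
    (eq_neg_one_of_reflSign_ne_one hsign)
  refine absurd ?_ (hmin (cs.wordProd L * p) ?_)
  · change cs.length (cs.wordProd L * p) < cs.length (cs.wordProd L)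
    have := cs.length_wordProd_le L'
    rw [hprod, hlen]
    lia
  · rw [Set.mem_ofPred_eq, mul_inv_rev, mul_assoc]
    exact mul_mem (inv_mem hp) hu₁

theorem reflSign_eq_one_of_forall_simple {Y : Set B} {u : W}
    (h : ∀ y ∈ Y, cs.reflSign u (cs.simple y) = 1) {p : W} (hp : p ∈ cs.parabolic Y) :
    cs.reflSign u p = 1 := by
  obtain ⟨u₁, d, hd, rfl, hu₁⟩ := cs.exists_minimal_mul_parabolic Y u
  suffices d = 1 by simpa [this] using hu₁ p hp
  refine cs.eq_one_of_mem_parabolic hd fun y hy => ?_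
  have := h y hy
  rwa [reflSign_mul, hu₁ _ (mul_mem (mul_mem hd (cs.simple_mem_parabolic hy)) (inv_mem hd)),
    mul_one] at this

/-- If `w` is minimal in its coset `w W_X` then, up to left multiplication by some `d` in a
standard parabolic subgroup `W_Y`, the reflections in `w X w⁻¹ ∩ W_Y` become simple. -/
theorem exists_conj_mem_simple {X Y : Set B} {w : W}
    (hw : ∀ t ∈ X, cs.reflSign w (cs.simple t) = 1) :
    ∃ d ∈ cs.parabolic Y, ∀ t ∈ X, w * cs.simple t * w⁻¹ ∈ cs.parabolic Y →
      ∃ y ∈ Y, (d * w) * cs.simple t * (d * w)⁻¹ = cs.simple y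
        ∧ cs.reflSign d⁻¹ (cs.simple y) = 1 := by
  obtain ⟨u, d, hd, hwd, hu⟩ := cs.exists_minimal_mul_parabolic Y w⁻¹
  refine ⟨d, hd, fun t ht hwt => ?_⟩
  have hdw : (d * w)⁻¹ = u := by rw [mul_inv_rev, hwd, mul_inv_cancel_right]
  have hmem : (d * w) * cs.simple t * (d * w)⁻¹ ∈ cs.parabolic Y := by
    have := mul_mem (mul_mem hd hwt) (inv_mem hd)
    simpa [mul_assoc] using this
  have hconj : u * ((d * w) * cs.simple t * (d * w)⁻¹) * u⁻¹ = cs.simple t := by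
    rw [← hdw]
    group
  have hpos : cs.reflSign d (w * cs.simple t * w⁻¹) = 1 := by
    have h1 := cs.reflSign_inv_conj (d * w) (cs.simple t)
    rw [hdw, hu _ (by rwa [← hdw]), reflSign_mul, hw t ht, one_mul] at h1
    exact h1.symm
  have hsimple : ∃ y ∈ Y, (d * w) * cs.simple t * (d * w)⁻¹ = cs.simple y := by
    by_contra! hne
    set γ := (d * w) * cs.simple t * (d * w)⁻¹ with hγ
    have h1 : cs.reflSign (cs.simple t * u) γ = 1 := by
      refine cs.reflSign_eq_one_of_forall_simple (fun y hy => ?_) hmem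
      rw [reflSign_mul, hu _ (cs.simple_mem_parabolic hy), one_mul]
      refine cs.reflSign_simple_of_ne t fun h => hne y hy ?_
      rw [← hconj] at h
      exact (conj_injective h).symm
    rw [reflSign_mul, hu γ hmem, hconj, reflSign_simple] at h1
    simp at h1
  obtain ⟨y, hy, h⟩ := hsimple
  refine ⟨y, hy, h, ?_⟩
  rw [← hpos, ← cs.reflSign_inv_conj d (w * cs.simple t * w⁻¹), ← h]
  simp [mul_assoc]

end CoxeterSystem

namespace LabelledGraph

section AltRev

variable {G : Type*}

/-- The `n`-th letter of the infinite alternating word `x y x y ⋯`. -/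
def altLetter (x y : G) (n : ℕ) : G := if Even n then x else y

theorem altLetter_succ (x y : G) (n : ℕ) : altLetter x y (n + 1) = altLetter y x n := by
  by_cases hn : Even n <;> simp [altLetter, Nat.even_add_one, hn]

theorem map_altLetter {H : Type*} (f : G → H) (x y : G) (n : ℕ) :
    f (altLetter x y n) = altLetter (f x) (f y) n :=
  apply_ite f _ _ _

/-- The alternating product `⋯ x y x` with `n` terms, the last of which is `x`. -/
def altRev [Monoid G] (x y : G) : ℕ → G
  | 0 => 1
  | n + 1 => altLetter x y n * altRev x y n

theorem altRev_eq_altProd [Monoid G] (x y : G) (n : ℕ) :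
    altRev x y n = if Even n then altProd y x n else altProd x y n := by
  induction n with
  | zero => simp [altRev, altProd]
  | succ n ih => by_cases hn : Even n <;> simp [altRev, altLetter, ih, hn, Nat.even_add_one, altProd]

theorem altRev_eq_comm_iff [Monoid G] (x y : G) (n : ℕ) :
    altRev x y n = altRev y x n ↔ altProd x y n = altProd y x n := by
  rw [altRev_eq_altProd, altRev_eq_altProd]
  split_ifs
  · exact eq_comm
  · rfl

theorem altRev_succ' [Monoid G] (x y : G) (n : ℕ) :
    altRev x y (n + 1) = altRev y x n * x := by
  induction n with
  | zero => simp [altRev, altLetter]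
  | succ n ih => rw [altRev, ih, altRev, altLetter_succ, mul_assoc]

theorem mul_mul_pow_succ_of_mul_self [Monoid G] {x y : G} (hx : x * x = 1) (n : ℕ) :
    x * (x * y) ^ (n + 1) = (y * x) ^ n * y := by
  rw [pow_succ', ← mul_assoc, ← mul_assoc, hx, one_mul, mul_pow_mul]

theorem altRev_succ_of_mul_self [Monoid G] {x y : G} (hx : x * x = 1) (hy : y * y = 1) (n : ℕ) :
    altRev x y (n + 1) = altRev x y n * ((x * y) ^ n * x) := by
  induction n generalizing x y with
  | zero => simp [altRev, altLetter]
  | succ n ih =>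
    rw [altRev_succ', ih hy hx, altRev_succ' x y, mul_assoc, mul_assoc (altRev y x n) x,
      ← mul_assoc x, mul_mul_pow_succ_of_mul_self hx, mul_assoc]

theorem altRev_comm_of_mul_self [Monoid G] {x y : G} (hx : x * x = 1) (hy : y * y = 1) (n : ℕ) :
    altRev x y n = altRev y x n * (y * x) ^ n := by
  induction n generalizing x y with
  | zero => simp [altRev]
  | succ n ih =>
    rw [altRev_succ', ih hy hx, altRev_succ' y x, mul_assoc, mul_assoc,
      mul_mul_pow_succ_of_mul_self hy, ih hx hy, mul_assoc]

end AltRev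

end LabelledGraph

namespace CoxeterSystem

open LabelledGraph

variable {B W : Type*} [Group W] {M : CoxeterMatrix B} (cs : CoxeterSystem M W)

theorem altRev_simple_succ (x y : B) (n : ℕ) :
    altRev (cs.simple x) (cs.simple y) (n + 1) = altRev (cs.simple x) (cs.simple y) n
      * ((cs.simple x * cs.simple y) ^ n * cs.simple x) :=
  altRev_succ_of_mul_self (by simp) (by simp) n

theorem altRev_simple_comm (x y : B) :
    altRev (cs.simple x) (cs.simple y) (M x y) = altRev (cs.simple y) (cs.simple x) (M x y) := by
  rw [altRev_comm_of_mul_self (by simp) (by simp), M.symmetric x y, cs.simple_mul_simple_pow,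
    mul_one]

theorem wordProd_eq_pow_mul_pow (x y : B) {L : List B} (hL : ∀ z ∈ L, z ∈ ({x, y} : Set B)) :
    ∃ j : ℤ, cs.wordProd L = (cs.simple x * cs.simple y) ^ j * cs.simple x ^ L.length := by
  induction L with
  | nil => exact ⟨0, by simp⟩
  | cons z L ih =>
    obtain ⟨j, hj⟩ := ih fun z hz => hL z (List.mem_cons_of_mem _ hz)
    have hconj : cs.simple x * (cs.simple x * cs.simple y) ^ j
        = (cs.simple x * cs.simple y) ^ (-j) * cs.simple x := by
      have h := conj_zpow (i := j) (a := cs.simple x) (b := cs.simple x * cs.simple y)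
      rw [← mul_inv_eq_iff_eq_mul, ← h, zpow_neg, ← inv_zpow]
      simp
    have hx : cs.simple x * cs.wordProd L
        = (cs.simple x * cs.simple y) ^ (-j) * cs.simple x ^ (L.length + 1) := by
      rw [hj, ← mul_assoc, hconj, mul_assoc, pow_succ']
    rw [wordProd_cons, List.length_cons]
    rcases hL z (by simp) with rfl | hz
    · exact ⟨-j, hx⟩
    · rw [Set.mem_singleton_iff.1 hz]
      refine ⟨-1 + -j, ?_⟩
      rw [zpow_add, mul_assoc, ← hx]
      simp [mul_assoc]

/-- Reflections in a finite dihedral parabolic subgroup. -/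
theorem exists_eq_pow_mul_simple {x y : B} (hM : M x y ≠ 0) {w : W} {t : B}
    (h : w * cs.simple t * w⁻¹ ∈ cs.parabolic {x, y}) :
    ∃ i < M x y, w * cs.simple t * w⁻¹ = (cs.simple x * cs.simple y) ^ i * cs.simple x := by
  obtain ⟨L, hL, hprod⟩ := cs.exists_wordProd_eq_of_mem_parabolic h
  obtain ⟨j, hj⟩ := cs.wordProd_eq_pow_mul_pow x y hL
  have hodd : Odd L.length := by
    have h1 : cs.lengthParity (cs.wordProd L) = Multiplicative.ofAdd (L.length : ZMod 2) := by
      rw [wordProd, map_list_prod, List.map_map, lengthParity_comp_simple, List.map_const',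
        List.prod_replicate, ← ofAdd_nsmul, nsmul_one]
    rw [hprod, map_mul, map_mul, map_inv, mul_right_comm, mul_inv_cancel, one_mul,
      cs.lengthParity_simple] at h1
    exact ZMod.natCast_eq_one_iff_odd.1 (Multiplicative.ofAdd.injective h1).symm
  have hpow : cs.simple x ^ L.length = cs.simple x := by
    obtain ⟨l, hl⟩ := hodd
    rw [hl, pow_succ, pow_mul]
    simp
  have hpos : (0 : ℤ) < M x y := by positivity
  have hlt := Int.emod_lt_of_pos j hpos
  have hnonneg := Int.emod_nonneg j hpos.ne'
  refine ⟨(j % M x y).toNat, by lia, ?_⟩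
  rw [← hprod, hj, hpow, ← zpow_natCast, Int.toNat_of_nonneg hnonneg,
    ← zpow_mod_orderOf _ j, cs.orderOf_simple_mul_simple]

theorem pow_mul_simple_inj {x y : B} {i j : ℕ} (hi : i < M x y) (hj : j < M x y)
    (h : (cs.simple x * cs.simple y) ^ i * cs.simple x
      = (cs.simple x * cs.simple y) ^ j * cs.simple x) : i = j := by
  have horder := cs.orderOf_simple_mul_simple x y
  refine pow_injOn_Iio_orderOf (x := cs.simple x * cs.simple y) ?_ ?_ (mul_right_cancel h)
  · rw [horder]; exact hi
  · rw [horder]; exact hj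

variable {X : Set B} {A : Type*} [Group A]

theorem conj_eq_of_mul_eq {e a r q s : W} (h : e * a = a * r)
    (h' : e * (a * q) = a * q * s) : q * s * q⁻¹ = r := by
  rw [mul_inv_eq_iff_eq_mul, ← mul_right_inj a, ← mul_assoc, ← h', ← mul_assoc, h, mul_assoc]

open Classical in
/-- The generator `v` moves `(a, w)` to `(a, v w)`, unless `v w = w t` for some `t ∈ X`, in which
case it multiplies `a` by the element attached to `t`. -/
noncomputable def twistFun (g : X → A) (v : B) (z : A × W) : A × W :=
  if h : ∃ t : X, cs.simple v * z.2 = z.2 * cs.simple t then (g h.choose * z.1, z.2)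
  else (z.1, cs.simple v * z.2)

theorem twistFun_of_eq (g : X → A) {v : B} {w : W} (t : X)
    (h : cs.simple v * w = w * cs.simple t) (a : A) :
    cs.twistFun g v (a, w) = (g t * a, w) := by
  have hex : ∃ t : X, cs.simple v * w = w * cs.simple t := ⟨t, h⟩
  have ht : hex.choose = t :=
    Subtype.ext (cs.simple_injective (mul_left_cancel (hex.choose_spec.symm.trans h)))
  rw [twistFun, dif_pos hex]
  exact Prod.ext (congrArg (g · * a) ht) rfl

theorem twistFun_of_ne (g : X → A) {v : B} {w : W}
    (h : ∀ t : X, cs.simple v * w ≠ w * cs.simple t) (a : A) :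
    cs.twistFun g v (a, w) = (a, cs.simple v * w) :=
  dif_neg fun ⟨t, ht⟩ => h t ht

theorem simple_mul_mul_ne {v : B} {w : W} (h : ∀ t : X, cs.simple v * w ≠ w * cs.simple t)
    (t : X) : cs.simple v * (cs.simple v * w) ≠ cs.simple v * w * cs.simple t := by
  intro ht
  rw [mul_assoc] at ht
  exact h t (mul_left_cancel ht)

/-- `twistFun` as a permutation. -/
noncomputable def twist (g : X → A) (v : B) : Equiv.Perm (A × W) where
  toFun := cs.twistFun g v
  invFun := cs.twistFun (fun t => (g t)⁻¹) v
  left_inv := fun ⟨a, w⟩ => by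
    by_cases h : ∃ t : X, cs.simple v * w = w * cs.simple t
    · obtain ⟨t, ht⟩ := h
      rw [cs.twistFun_of_eq _ t ht, cs.twistFun_of_eq _ t ht, inv_mul_cancel_left]
    · push Not at h
      rw [cs.twistFun_of_ne _ h, cs.twistFun_of_ne _ (cs.simple_mul_mul_ne h)]
      simp
  right_inv := fun ⟨a, w⟩ => by
    by_cases h : ∃ t : X, cs.simple v * w = w * cs.simple t
    · obtain ⟨t, ht⟩ := h
      rw [cs.twistFun_of_eq _ t ht, cs.twistFun_of_eq _ t ht, mul_inv_cancel_left]
    · push Not at h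
      rw [cs.twistFun_of_ne _ h, cs.twistFun_of_ne _ (cs.simple_mul_mul_ne h)]
      simp

theorem twist_of_eq (g : X → A) {v : B} {w : W} (t : X)
    (h : cs.simple v * w = w * cs.simple t) (a : A) :
    cs.twist g v (a, w) = (g t * a, w) :=
  cs.twistFun_of_eq g t h a

theorem twist_of_ne (g : X → A) {v : B} {w : W}
    (h : ∀ t : X, cs.simple v * w ≠ w * cs.simple t) (a : A) :
    cs.twist g v (a, w) = (a, cs.simple v * w) :=
  cs.twistFun_of_ne g h a

/-- The elements `w` of minimal length in their coset `w W_X`. -/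
def IsMinimalRep (X : Set B) (w : W) : Prop := ∀ t ∈ X, cs.reflSign w (cs.simple t) = 1

variable {cs} in
theorem IsMinimalRep.simple_mul {w : W} (hw : cs.IsMinimalRep X w) {v : B}
    (h : ∀ t : X, cs.simple v * w ≠ w * cs.simple t) : cs.IsMinimalRep X (cs.simple v * w) := by
  intro t ht
  rw [reflSign_mul, hw t ht, one_mul]
  refine cs.reflSign_simple_of_ne v fun hv => h ⟨t, ht⟩ ?_
  exact (mul_inv_eq_iff_eq_mul.1 hv).symm

theorem isMinimalRep_twist_iff (g : X → A) (v : B) (z : A × W) :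
    cs.IsMinimalRep X (cs.twist g v z).2 ↔ cs.IsMinimalRep X z.2 := by
  obtain ⟨a, w⟩ := z
  by_cases h : ∃ t : X, cs.simple v * w = w * cs.simple t
  · obtain ⟨t, ht⟩ := h
    rw [cs.twist_of_eq g t ht]
  · push Not at h
    rw [cs.twist_of_ne g h]
    refine ⟨fun hw => ?_, fun hw => hw.simple_mul h⟩
    simpa using hw.simple_mul (cs.simple_mul_mul_ne h)

theorem simple_altLetter_mul_altRev (x y : B) (n : ℕ) :
    cs.simple (altLetter x y n) * altRev (cs.simple x) (cs.simple y) n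
      = altRev (cs.simple x) (cs.simple y) n
        * ((cs.simple x * cs.simple y) ^ n * cs.simple x) := by
  rw [map_altLetter cs.simple, ← altRev, altRev_simple_succ]

theorem pow_mul_simple_mem_parabolic (x y : B) (n : ℕ) :
    (cs.simple x * cs.simple y) ^ n * cs.simple x ∈ cs.parabolic {x, y} :=
  mul_mem (pow_mem (mul_mem (cs.simple_mem_parabolic (by simp))
    (cs.simple_mem_parabolic (by simp))) n) (cs.simple_mem_parabolic (by simp))

/-- The action of `altRev` when no letter is absorbed. -/
theorem altRev_twist_of_forall_not_mem (g : X → A) {x y : B} {w : W}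
    (h : ∀ t : X, w * cs.simple t * w⁻¹ ∉ cs.parabolic {x, y}) (a : A) (n : ℕ) :
    altRev (cs.twist g x) (cs.twist g y) n (a, w)
      = (a, altRev (cs.simple x) (cs.simple y) n * w) := by
  induction n with
  | zero => simp [altRev]
  | succ n ih =>
    rw [altRev, Equiv.Perm.mul_apply, ih, ← map_altLetter (cs.twist g), cs.twist_of_ne,
      ← mul_assoc, map_altLetter cs.simple, altRev]
    intro t ht
    refine h t ?_
    rw [conj_eq_of_mul_eq (cs.simple_altLetter_mul_altRev x y n) ht]
    exact cs.pow_mul_simple_mem_parabolic x y n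

open Classical in
/-- The action of `altRev` when exactly one letter is absorbed. -/
theorem altRev_twist_of_unique (g : X → A) {x y : B} {w : W} (t : X)
    (ht : w * cs.simple t * w⁻¹ ∈ cs.parabolic {x, y})
    (huniq : ∀ t' : X, w * cs.simple t' * w⁻¹ ∈ cs.parabolic {x, y} → t' = t) (a : A) {n : ℕ}
    (hn : n ≤ M x y) :
    altRev (cs.twist g x) (cs.twist g y) n (a, w)
      = if ∃ i < n, w * cs.simple t * w⁻¹ = (cs.simple x * cs.simple y) ^ i * cs.simple x
        then (g t * a, altRev (cs.simple x) (cs.simple y) n * (w * cs.simple t * w⁻¹) * w)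
        else (a, altRev (cs.simple x) (cs.simple y) n * w) := by
  induction n with
  | zero => simp [altRev]
  | succ n ih =>
    have hletter := cs.simple_altLetter_mul_altRev x y n
    rw [altRev, Equiv.Perm.mul_apply, ih (by lia), ← map_altLetter (cs.twist g)]
    by_cases hex : ∃ i < n,
        w * cs.simple t * w⁻¹ = (cs.simple x * cs.simple y) ^ i * cs.simple x
    · have hex' : ∃ i < n + 1,
          w * cs.simple t * w⁻¹ = (cs.simple x * cs.simple y) ^ i * cs.simple x := by
        obtain ⟨i, hi, h⟩ := hex
        exact ⟨i, by lia, h⟩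
      rw [if_pos hex, if_pos hex', cs.twist_of_ne, altRev, ← map_altLetter cs.simple]
      · simp only [mul_assoc]
      intro t' ht'
      obtain ⟨i, hi, h⟩ := hex
      set p := w * cs.simple t * w⁻¹ with hp
      rw [mul_assoc _ p w] at ht'
      have h1 := conj_eq_of_mul_eq hletter ht'
      have h2 : w * cs.simple t' * w⁻¹
          = p⁻¹ * ((cs.simple x * cs.simple y) ^ n * cs.simple x) * p := by
        rw [← h1]
        group
      have h3 : t' = t := huniq t' <| h2 ▸
        mul_mem (mul_mem (inv_mem ht) (cs.pow_mul_simple_mem_parabolic x y n)) ht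
      rw [h3, ← hp, mul_assoc, eq_inv_mul_iff_mul_eq, mul_left_inj, h] at h2
      exact hi.ne (cs.pow_mul_simple_inj (by lia) (by lia) h2)
    · rw [if_neg hex]
      by_cases hn' : w * cs.simple t * w⁻¹ = (cs.simple x * cs.simple y) ^ n * cs.simple x
      · rw [if_pos ⟨n, by lia, hn'⟩, cs.twist_of_eq g t, altRev_simple_succ, ← hn']
        · simp [mul_assoc]
        · rw [← mul_assoc, hletter, ← hn']
          simp [mul_assoc]
      · rw [if_neg, cs.twist_of_ne, altRev, ← map_altLetter cs.simple, mul_assoc]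
        · intro t' ht'
          have h1 := conj_eq_of_mul_eq hletter ht'
          have h2 : t' = t := huniq t' (h1 ▸ cs.pow_mul_simple_mem_parabolic x y n)
          exact hn' (h2 ▸ h1)
        · rintro ⟨i, hi, h⟩
          rcases Nat.lt_succ_iff_lt_or_eq.1 hi with hi | rfl
          · exact hex ⟨i, hi, h⟩
          · exact hn' h

/-- The action of `altRev` when every letter is absorbed. -/
theorem altRev_twist_of_eq_of_eq (g : X → A) {x y : B} {w : W} (t t' : X)
    (hx : cs.simple x * w = w * cs.simple t) (hy : cs.simple y * w = w * cs.simple t') (a : A)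
    (n : ℕ) :
    altRev (cs.twist g x) (cs.twist g y) n (a, w) = (altRev (g t) (g t') n * a, w) := by
  induction n with
  | zero => simp [altRev]
  | succ n ih =>
    rw [altRev, Equiv.Perm.mul_apply, ih, altRev, altLetter, altLetter]
    split_ifs
    · rw [cs.twist_of_eq g t hx, mul_assoc]
    · rw [cs.twist_of_eq g t' hy, mul_assoc]

theorem altRev_twist_comm_of_eq_of_eq {g : X → A}
    (hg : ∀ t t' : X, t ≠ t' → M t t' ≠ 0 →
      altProd (g t) (g t') (M t t') = altProd (g t') (g t) (M t t'))
    {x y : B} (hxy : x ≠ y) (hM : M x y ≠ 0) {w : W} (t t' : X)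
    (hx : cs.simple x * w = w * cs.simple t) (hy : cs.simple y * w = w * cs.simple t') (a : A) :
    altRev (cs.twist g x) (cs.twist g y) (M x y) (a, w)
      = altRev (cs.twist g y) (cs.twist g x) (M x y) (a, w) := by
  have htt' : t ≠ t' := by
    rintro rfl
    exact hxy (cs.simple_injective (mul_right_cancel (hx.trans hy.symm)))
  have hMeq : M t t' = M x y := by
    rw [← cs.orderOf_simple_mul_simple, ← cs.orderOf_simple_mul_simple]
    exact SemiconjBy.orderOf_eq w (SemiconjBy.mul_right hx.symm hy.symm)
  rw [cs.altRev_twist_of_eq_of_eq g t t' hx hy, cs.altRev_twist_of_eq_of_eq g t' t hy hx,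
    (altRev_eq_comm_iff _ _ _).2 (hMeq ▸ hg t t' htt' (hMeq ▸ hM))]

theorem altRev_twist_comm {g : X → A}
    (hg : ∀ t t' : X, t ≠ t' → M t t' ≠ 0 →
      altProd (g t) (g t') (M t t') = altProd (g t') (g t) (M t t'))
    {x y : B} (hxy : x ≠ y) (hM : M x y ≠ 0) {w : W} (hw : cs.IsMinimalRep X w) (a : A) :
    altRev (cs.twist g x) (cs.twist g y) (M x y) (a, w)
      = altRev (cs.twist g y) (cs.twist g x) (M x y) (a, w) := by
  have hpair : ({y, x} : Set B) = {x, y} := Set.pair_comm y x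
  by_cases h0 : ∀ t : X, w * cs.simple t * w⁻¹ ∉ cs.parabolic {x, y}
  · rw [cs.altRev_twist_of_forall_not_mem g h0,
      cs.altRev_twist_of_forall_not_mem g (hpair ▸ h0), altRev_simple_comm]
  push Not at h0
  obtain ⟨t, ht⟩ := h0
  by_cases huniq : ∀ t' : X, w * cs.simple t' * w⁻¹ ∈ cs.parabolic {x, y} → t' = t
  · have hM' : M y x = M x y := M.symmetric y x
    have ht' : w * cs.simple t * w⁻¹ ∈ cs.parabolic {y, x} := hpair ▸ ht
    have h1 := cs.exists_eq_pow_mul_simple hM ht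
    have h2 := cs.exists_eq_pow_mul_simple (hM'.trans_ne hM) ht'
    rw [hM'] at h2
    rw [cs.altRev_twist_of_unique g t ht huniq a le_rfl, if_pos h1,
      cs.altRev_twist_of_unique g t ht' (hpair ▸ huniq) a hM'.ge, if_pos h2, altRev_simple_comm]
  push Not at huniq
  obtain ⟨t', ht', hne⟩ := huniq
  obtain ⟨d, hd, H⟩ := cs.exists_conj_mem_simple (Y := {x, y}) hw
  obtain ⟨u, hu, hut, hud⟩ := H t t.2 ht
  obtain ⟨u', hu', hut', hud'⟩ := H t' t'.2 ht'
  have huu' : u ≠ u' := by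
    rintro rfl
    exact hne (Subtype.ext (cs.simple_injective (conj_injective (hut'.trans hut.symm))))
  have hd1 : d = 1 := by
    rw [← inv_eq_one]
    refine cs.eq_one_of_mem_parabolic (inv_mem hd) fun z hz => ?_
    have : z = u ∨ z = u' := by
      simp only [Set.mem_insert_iff, Set.mem_singleton_iff] at hu hu' hz
      grind
    rcases this with rfl | rfl <;> assumption
  rw [hd1, one_mul, mul_inv_eq_iff_eq_mul, eq_comm] at hut hut'
  rcases hu with rfl | hu <;> rcases hu' with rfl | hu'
  · exact absurd rfl huu'
  · rw [Set.mem_singleton_iff] at hu'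
    subst hu'
    exact cs.altRev_twist_comm_of_eq_of_eq hg hxy hM t t' hut hut' a
  · rw [Set.mem_singleton_iff] at hu
    subst hu
    exact cs.altRev_twist_comm_of_eq_of_eq hg hxy hM t' t hut' hut a
  · exact absurd (hu.trans hu'.symm) huu'

/-- `twist` restricted to the pairs whose second component is a minimal coset representative. -/
noncomputable def minimalTwist (g : X → A) (v : B) :
    Equiv.Perm {z : A × W // cs.IsMinimalRep X z.2} :=
  (cs.twist g v).subtypePerm (cs.isMinimalRep_twist_iff g v)

theorem coe_altProd_minimalTwist (g : X → A) (x y : B) (n : ℕ)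
    (z : {z : A × W // cs.IsMinimalRep X z.2}) :
    (altProd (cs.minimalTwist g x) (cs.minimalTwist g y) n z : A × W)
      = altProd (cs.twist g x) (cs.twist g y) n z := by
  induction n generalizing x y with
  | zero => rfl
  | succ n ih =>
    rw [altProd, altProd, Equiv.Perm.mul_apply, Equiv.Perm.mul_apply, ← ih y x]
    rfl

theorem altProd_minimalTwist_comm {g : X → A}
    (hg : ∀ t t' : X, t ≠ t' → M t t' ≠ 0 →
      altProd (g t) (g t') (M t t') = altProd (g t') (g t) (M t t'))
    {x y : B} (hxy : x ≠ y) (hM : M x y ≠ 0) :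
    altProd (cs.minimalTwist g x) (cs.minimalTwist g y) (M x y)
      = altProd (cs.minimalTwist g y) (cs.minimalTwist g x) (M x y) := by
  ext1 ⟨⟨a, w⟩, hw⟩
  have h := cs.altRev_twist_comm hg hxy hM hw a
  apply Subtype.ext
  rw [coe_altProd_minimalTwist, coe_altProd_minimalTwist]
  rw [altRev_eq_altProd, altRev_eq_altProd] at h
  split_ifs at h
  · exact h.symm
  · exact h

end CoxeterSystem

namespace LabelledGraph

variable {V : Type*} (Γ : LabelledGraph V)

theorem altProd_σ {u v : V} (huv : u ≠ v) {k : ℕ} (hk : Γ.m u v = k) :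
    altProd (Γ.σ u) (Γ.σ v) k = altProd (Γ.σ v) (Γ.σ u) k := by
  have h : PresentedGroup.mk Γ.artinRels (altWord u v k * (altWord v u k)⁻¹) = 1 :=
    (QuotientGroup.eq_one_iff _).2 (Subgroup.subset_normalClosure ⟨u, v, k, huv, hk, rfl⟩)
  rw [map_mul, map_inv, mul_inv_eq_one, altWord, altWord, map_altProd, map_altProd] at h
  exact h

/-- The homomorphism out of an Artin group given by elements satisfying the braid relations. -/
def liftHom {G : Type*} [Group G] (f : V → G)
    (hf : ∀ u v, u ≠ v → ∀ k : ℕ, Γ.m u v = k → altProd (f u) (f v) k = altProd (f v) (f u) k) :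
    Γ.ArtinGroup →* G :=
  PresentedGroup.toGroup (f := f) (by
    rintro r ⟨u, v, k, huv, hk, rfl⟩
    rw [map_mul, map_inv, mul_inv_eq_one, altWord, altWord, map_altProd, map_altProd]
    simpa using hf u v huv k hk)

@[simp]
theorem liftHom_σ {G : Type*} [Group G] (f : V → G)
    (hf : ∀ u v, u ≠ v → ∀ k : ℕ, Γ.m u v = k → altProd (f u) (f v) k = altProd (f v) (f u) k)
    (v : V) : Γ.liftHom f hf (Γ.σ v) = f v :=
  PresentedGroup.toGroup.of _

theorem closure_range_σ : Subgroup.closure (Set.range Γ.σ) = ⊤ :=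
  PresentedGroup.closure_range_of _

theorem hom_ext {G : Type*} [Group G] {f f' : Γ.ArtinGroup →* G}
    (h : ∀ v, f (Γ.σ v) = f' (Γ.σ v)) : f = f' :=
  PresentedGroup.ext h

@[simp]
theorem inclHom_σ (K : Set V) (v : K) : Γ.inclHom K ((Γ.induce K).σ v) = Γ.σ v :=
  mapHom_σ _ _ _ _ _ v

theorem range_inclHom (K : Set V) : (Γ.inclHom K).range = Γ.specialSubgroup K := by
  rw [MonoidHom.range_eq_map, ← closure_range_σ, MonoidHom.map_closure, specialSubgroup,
    ← Set.range_comp, Set.image_eq_range]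
  congr 2

open Classical in
/-- The Coxeter matrix of a labelled graph. -/
noncomputable def coxeterMatrix : CoxeterMatrix V where
  M u v := if u = v then 1 else (Γ.m u v).toNat
  isSymm := by
    ext u v
    simp [Matrix.transpose, Γ.symm u v, eq_comm]
  diagonal u := by simp
  off_diagonal u v huv := by
    rw [if_neg huv]
    intro h
    have h2 := Γ.two_le u v huv
    cases hm : Γ.m u v with
    | top => simp [hm] at h
    | coe k =>
      rw [hm] at h h2
      have : 2 ≤ k := by exact_mod_cast h2
      rw [ENat.toNat_natCast] at h
      lia

theorem coxeterMatrix_apply_of_ne {u v : V} (huv : u ≠ v) :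
    Γ.coxeterMatrix u v = (Γ.m u v).toNat :=
  if_neg huv

/-- The action of an Artin group on pairs consisting of an element of the Artin group of an induced
subgraph and a minimal coset representative in the Coxeter group. -/
noncomputable def actHom (K : Set V) : Γ.ArtinGroup →*
    Equiv.Perm {z : (Γ.induce K).ArtinGroup × Γ.coxeterMatrix.Group //
      Γ.coxeterMatrix.toCoxeterSystem.IsMinimalRep K z.2} :=
  Γ.liftHom (Γ.coxeterMatrix.toCoxeterSystem.minimalTwist (Γ.induce K).σ) <| by
    intro u v huv k hk
    have hM : Γ.coxeterMatrix u v = k := by rw [Γ.coxeterMatrix_apply_of_ne huv, hk]; rfl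
    have hk0 : k ≠ 0 := by
      rintro rfl
      have := Γ.two_le u v huv
      simp [hk] at this
    rw [← hM]
    refine CoxeterSystem.altProd_minimalTwist_comm _ (fun t t' htt' h0 => ?_) huv (hM.trans_ne hk0)
    refine (Γ.induce K).altProd_σ htt' ?_
    rw [Γ.coxeterMatrix_apply_of_ne (Subtype.coe_ne_coe.2 htt')] at h0 ⊢
    exact (ENat.natCast_toNat fun htop : Γ.m t t' = ⊤ => h0 (by rw [htop]; rfl)).symm

theorem isMinimalRep_one (K : Set V) :
    Γ.coxeterMatrix.toCoxeterSystem.IsMinimalRep K 1 :=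
  fun _ _ => CoxeterSystem.reflSign_one _ _

theorem actHom_inclHom (K : Set V) (g a : (Γ.induce K).ArtinGroup) :
    Γ.actHom K (Γ.inclHom K g) ⟨(a, 1), Γ.isMinimalRep_one K⟩
      = ⟨(g * a, 1), Γ.isMinimalRep_one K⟩ := by
  have hg : g ∈ Subgroup.closure (Set.range (Γ.induce K).σ) := by
    rw [closure_range_σ]; trivial
  have hσ (v : K) (a : (Γ.induce K).ArtinGroup) :
      Γ.actHom K (Γ.inclHom K ((Γ.induce K).σ v)) ⟨(a, 1), Γ.isMinimalRep_one K⟩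
        = ⟨((Γ.induce K).σ v * a, 1), Γ.isMinimalRep_one K⟩ := by
    rw [inclHom_σ, actHom, liftHom_σ]
    exact Subtype.ext (CoxeterSystem.twist_of_eq _ _ v (by simp) a)
  induction hg using Subgroup.closure_induction generalizing a with
  | mem x hx =>
    obtain ⟨v, rfl⟩ := hx
    exact hσ v a
  | one => simp
  | mul x y _ _ hx hy => rw [map_mul, map_mul, Equiv.Perm.mul_apply, hy, hx, mul_assoc]
  | inv x _ hx => rw [map_inv, map_inv, Equiv.Perm.inv_eq_iff_eq, hx, mul_inv_cancel_left]

/-- The Artin group of an induced subgraph embeds (van der Lek). -/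
theorem inclHom_injective (K : Set V) : Function.Injective (Γ.inclHom K) := by
  intro g g' h
  have h1 := Γ.actHom_inclHom K g 1
  rw [h, actHom_inclHom] at h1
  simpa using (congrArg (fun z => z.1.1) h1).symm

theorem σ_mem_specialSubgroup_iff {K : Set V} {v : V} :
    Γ.σ v ∈ Γ.specialSubgroup K ↔ v ∈ K := by
  refine ⟨fun h => ?_, fun h => Subgroup.subset_closure ⟨v, h, rfl⟩⟩
  by_contra hv
  rw [← range_inclHom] at h
  obtain ⟨g, hg⟩ := h
  have h1 := Γ.actHom_inclHom K g 1
  rw [hg, actHom, liftHom_σ] at h1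
  have h2 := congrArg (fun z => z.1.2) h1
  have h3 := CoxeterSystem.twist_of_ne Γ.coxeterMatrix.toCoxeterSystem (X := K) (w := 1)
    (Γ.induce K).σ (v := v) (fun t ht => hv ?_) 1
  · have h4 : (Γ.coxeterMatrix.toCoxeterSystem.twist (Γ.induce K).σ v (1, 1)).2 = 1 := h2
    have h5 := Γ.coxeterMatrix.toCoxeterSystem.length_simple v
    rw [h3, mul_one] at h4
    rw [show Γ.coxeterMatrix.toCoxeterSystem.simple v = 1 from h4, CoxeterSystem.length_one] at h5
    exact zero_ne_one h5
  · rw [mul_one, one_mul] at ht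
    rw [CoxeterSystem.simple_injective _ ht]
    exact t.2

end LabelledGraph

namespace Monoid.PushoutI

variable {ι : Type*} {G : ι → Type*} {H : Type*} [∀ i, Group (G i)] [Group H]
  {φ : ∀ i, H →* G i}

/-- Consecutive letters lie in different factors, and no letter lies in the base. -/
def IsReducedList (φ : ∀ i, H →* G i) (l : List (Σ i, G i)) : Prop :=
  (∀ g ∈ l, g.2 ∉ (φ g.1).range) ∧ l.IsChain fun a b => a.1 ≠ b.1

/-- The element of the pushout spelled by a list of letters. -/
def listProd (φ : ∀ i, H →* G i) (l : List (Σ i, G i)) : PushoutI φ :=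
  (l.map fun g => of g.1 g.2).prod

theorem exists_normalWord_of_isReducedList (d : NormalWord.Transversal φ) {l : List (Σ i, G i)}
    (hl : IsReducedList φ l) :
    ∃ w : NormalWord d, w.prod = listProd φ l ∧
      w.toList.map Sigma.fst = l.map Sigma.fst := by
  have hred : Reduced φ ⟨l, fun g hg h1 => hl.1 g hg (h1 ▸ one_mem _), hl.2⟩ := hl.1
  obtain ⟨w, hw, hlist⟩ := hred.exists_normalWord_prod_eq d
  refine ⟨w, hw.trans ?_, hlist⟩
  rw [CoprodI.Word.prod, map_list_prod, List.map_map, listProd]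
  congr 1

theorem map_fst_eq_of_base_mul_listProd_eq (hφ : ∀ i, Function.Injective (φ i))
    {l l' : List (Σ i, G i)} (hl : IsReducedList φ l) (hl' : IsReducedList φ l') {c c' : H}
    (h : base φ c * listProd φ l = base φ c' * listProd φ l') :
    l.map Sigma.fst = l'.map Sigma.fst := by
  obtain ⟨d⟩ := NormalWord.transversal_nonempty φ hφ
  classical
  obtain ⟨w, hw, hlist⟩ := exists_normalWord_of_isReducedList d hl
  obtain ⟨w', hw', hlist'⟩ := exists_normalWord_of_isReducedList d hl'
  rw [← hw, ← hw', ← NormalWord.prod_base_smul, ← NormalWord.prod_base_smul] at h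
  rw [← hlist, ← hlist']
  have hlists := congrArg (fun v : NormalWord d => v.toList.map Sigma.fst)
    (NormalWord.prod_injective h)
  exact hlists

theorem exists_eq_base_mul_listProd (hφ : ∀ i, Function.Injective (φ i)) (z : PushoutI φ) :
    ∃ c l, IsReducedList φ l ∧ z = base φ c * listProd φ l := by
  obtain ⟨d⟩ := NormalWord.transversal_nonempty φ hφ
  classical
  obtain ⟨w, rfl⟩ := (NormalWord.equiv (d := d)).symm.surjective z
  refine ⟨w.head, w.toList, ⟨fun ⟨i, g⟩ hg hr => ?_, w.chain_ne⟩, ?_⟩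
  · refine w.ne_one _ hg ?_
    have h := (d.compl i).1 (a₁ := (⟨g, hr⟩, ⟨1, d.one_mem i⟩))
      (a₂ := (⟨1, one_mem _⟩, ⟨g, w.normalized i g hg⟩)) (by simp)
    exact congrArg (fun p => p.1.1) h
  · change NormalWord.prod w = _
    rw [NormalWord.prod, CoprodI.Word.prod, map_list_prod, List.map_map, listProd]
    congr 2

theorem mem_range_base_of_commute [Nontrivial ι] (hφ : ∀ i, Function.Injective (φ i))
    {x : ∀ i, G i} (hx : ∀ i, x i ∉ (φ i).range) {z : PushoutI φ}
    (hz : ∀ i, Commute z (of i (x i))) : z ∈ (base φ).range := by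
  obtain ⟨c, l, hl, rfl⟩ := exists_eq_base_mul_listProd hφ z
  rcases l.eq_nil_or_concat' with rfl | ⟨l₀, g₀, h₀⟩
  · exact ⟨c, by simp [listProd]⟩
  exfalso
  obtain ⟨k, hk⟩ := exists_ne g₀.1
  have hxc : x k * φ k c ∉ (φ k).range := fun h =>
    hx k ((Subgroup.mul_mem_cancel_right _ (MonoidHom.mem_range.2 ⟨c, rfl⟩)).1 h)
  have hright : IsReducedList φ (l ++ [⟨k, x k⟩]) := by
    refine ⟨fun g hg => ?_, hl.2.append (List.isChain_singleton _) ?_⟩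
    · rcases List.mem_append.1 hg with hg | hg
      · exact hl.1 g hg
      · rw [List.mem_singleton.1 hg]
        exact hx k
    · subst h₀
      simpa using hk.symm
  have hprod : base φ c * listProd φ (l ++ [⟨k, x k⟩])
      = of k (x k * φ k c) * listProd φ l := by
    have := (hz k).eq
    rw [map_mul, of_apply_eq_base]
    simpa [listProd, mul_assoc] using this
  obtain ⟨⟨i, g⟩, l', rfl⟩ : ∃ g l', l = g :: l' := by
    cases l with
    | nil => simp at h₀
    | cons g l' => exact ⟨g, l', rfl⟩
  have hl' : IsReducedList φ l' :=
    ⟨fun g hg => hl.1 g (List.mem_cons_of_mem _ hg), hl.2.tail⟩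
  by_cases hik : i = k
  · subst hik
    by_cases hmem : x i * φ i c * g ∈ (φ i).range
    · obtain ⟨c', hc'⟩ := hmem
      have := map_fst_eq_of_base_mul_listProd_eq hφ hright hl' (c' := c') (hprod.trans (by
        rw [← of_apply_eq_base φ i c', hc']
        simp [listProd, mul_assoc]))
      have := congrArg List.length this
      simp at this
      lia
    · have hred : IsReducedList φ (⟨i, x i * φ i c * g⟩ :: l') := by
        refine ⟨fun g' hg' => ?_, ?_⟩
        · rcases List.mem_cons.1 hg' with rfl | hg'
          · exact hmem
          · exact hl'.1 g' hg'
        · have := hl.2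
          rw [List.isChain_cons] at this ⊢
          exact this
      have := map_fst_eq_of_base_mul_listProd_eq hφ hright hred (c' := 1) (hprod.trans (by
        simp [listProd, mul_assoc]))
      simpa using congrArg List.length this
  · have hred : IsReducedList φ (⟨k, x k * φ k c⟩ :: ⟨i, g⟩ :: l') := by
      refine ⟨fun g' hg' => ?_, ?_⟩
      · rcases List.mem_cons.1 hg' with rfl | hg'
        · exact hxc
        · exact hl.1 g' hg'
      · exact List.isChain_cons_cons.2 ⟨Ne.symm hik, hl.2⟩
    have := map_fst_eq_of_base_mul_listProd_eq hφ hright hred (c' := 1) (hprod.trans (by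
      simp [listProd, mul_assoc]))
    simp only [List.cons_append, List.map_cons, List.cons.injEq] at this
    exact hik this.1

end Monoid.PushoutI

namespace LabelledGraph

open Monoid

variable {V : Type*} (Γ : LabelledGraph V)

theorem specialSubgroup_mono {K K' : Set V} (h : K ⊆ K') :
    Γ.specialSubgroup K ≤ Γ.specialSubgroup K' :=
  Subgroup.closure_mono (Set.image_mono h)

/-- The two endpoints of a missing edge, indexed by booleans. -/
def endpoint (t v : V) (i : Bool) : V := bif i then t else v

/-- The inclusion of the special subgroup avoiding both endpoints in the one avoiding one. -/
def endpointInclusion (t v : V) (i : Bool) :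
    Γ.specialSubgroup {t, v}ᶜ →* Γ.specialSubgroup {endpoint t v i}ᶜ :=
  Subgroup.inclusion <| Γ.specialSubgroup_mono <| Set.compl_subset_compl.2 <| by
    cases i <;> simp [endpoint]

theorem endpointInclusion_injective (t v : V) (i : Bool) :
    Function.Injective (Γ.endpointInclusion t v i) :=
  Subgroup.inclusion_injective _

open Classical in
/-- The image of a standard generator in the amalgam. -/
noncomputable def amalgamGen {t v : V} (htv : t ≠ v) (u : V) :
    PushoutI (Γ.endpointInclusion t v) :=
  if h : u ≠ t then PushoutI.of true ⟨Γ.σ u, Γ.σ_mem_specialSubgroup_iff.2 h⟩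
  else PushoutI.of false ⟨Γ.σ u, Γ.σ_mem_specialSubgroup_iff.2 fun h' => htv <|
    (not_not.1 h).symm.trans h'⟩

theorem amalgamGen_eq {t v : V} (htv : t ≠ v) (i : Bool) {u : V} (hu : u ≠ endpoint t v i) :
    Γ.amalgamGen htv u = PushoutI.of i ⟨Γ.σ u, Γ.σ_mem_specialSubgroup_iff.2 hu⟩ := by
  by_cases hut : u = t
  · cases i with
    | true => exact absurd hut hu
    | false => rw [amalgamGen, dif_neg (not_not.2 hut)]
  · rw [amalgamGen, dif_pos hut]
    cases i with
    | true => rfl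
    | false =>
      have hmem : Γ.σ u ∈ Γ.specialSubgroup {t, v}ᶜ :=
        Γ.σ_mem_specialSubgroup_iff.2 (by rintro (h | h); exacts [hut h, hu h])
      exact (PushoutI.of_apply_eq_base (Γ.endpointInclusion t v) true ⟨_, hmem⟩).trans
        (PushoutI.of_apply_eq_base (Γ.endpointInclusion t v) false ⟨_, hmem⟩).symm

/-- The Artin group maps to the amalgam determined by a missing edge. -/
noncomputable def toAmalgam {t v : V} (htv : t ≠ v) (hm : Γ.m t v = ⊤) :
    Γ.ArtinGroup →* PushoutI (Γ.endpointInclusion t v) :=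
  Γ.liftHom (Γ.amalgamGen htv) <| by
    intro a b hab k hk
    obtain ⟨i, ha, hb⟩ : ∃ i, a ≠ endpoint t v i ∧ b ≠ endpoint t v i := by
      by_contra! hne
      have h1 := hne true
      have h2 := hne false
      simp only [endpoint, cond_true, cond_false] at h1 h2
      have htop : Γ.m a b = ⊤ := by
        by_cases hat : a = t
        · rw [hat, h2 fun hav => htv (hat.symm.trans hav), hm]
        · have hbt := h1 hat
          have hav : a = v := not_not.1 fun hav => htv (hbt.symm.trans (h2 hav))
          rw [hbt, hav, Γ.symm, hm]
      rw [hk] at htop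
      exact ENat.natCast_ne_top k htop
    rw [Γ.amalgamGen_eq htv i ha, Γ.amalgamGen_eq htv i hb, ← map_altProd, ← map_altProd]
    congr 1
    apply Subtype.ext
    have := map_altProd (Γ.specialSubgroup {endpoint t v i}ᶜ).subtype
    rw [← Subgroup.subtype_apply, ← Subgroup.subtype_apply, this, this]
    exact Γ.altProd_σ hab hk

theorem subtype_comp_endpointInclusion (t v : V) (i : Bool) :
    (Γ.specialSubgroup {endpoint t v i}ᶜ).subtype.comp (Γ.endpointInclusion t v i) =
      (Γ.specialSubgroup {t, v}ᶜ).subtype := rfl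

/-- The inverse of `toAmalgam`. -/
def ofAmalgam (t v : V) : PushoutI (Γ.endpointInclusion t v) →* Γ.ArtinGroup :=
  PushoutI.lift (fun i => (Γ.specialSubgroup {endpoint t v i}ᶜ).subtype)
    (Γ.specialSubgroup {t, v}ᶜ).subtype (Γ.subtype_comp_endpointInclusion t v)

theorem ofAmalgam_toAmalgam {t v : V} (htv : t ≠ v) (hm : Γ.m t v = ⊤) (z : Γ.ArtinGroup) :
    Γ.ofAmalgam t v (Γ.toAmalgam htv hm z) = z := by
  suffices h : (Γ.ofAmalgam t v).comp (Γ.toAmalgam htv hm) = MonoidHom.id _ from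
    DFunLike.congr_fun h z
  refine Γ.hom_ext fun u => ?_
  rw [MonoidHom.comp_apply, toAmalgam, liftHom_σ, amalgamGen]
  split_ifs <;> rw [ofAmalgam, PushoutI.lift_of] <;> rfl

/-- An element commuting with both endpoints of a missing edge avoids these endpoints. -/
theorem mem_specialSubgroup_of_commute {t v : V} (htv : t ≠ v) (hm : Γ.m t v = ⊤)
    {z : Γ.ArtinGroup} (ht : Commute z (Γ.σ t)) (hv : Commute z (Γ.σ v)) :
    z ∈ Γ.specialSubgroup {t, v}ᶜ := by
  have hne (i : Bool) : endpoint t v (!i) ≠ endpoint t v i := by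
    cases i
    · exact htv
    · exact htv.symm
  have hz : Γ.toAmalgam htv hm z ∈ (PushoutI.base (Γ.endpointInclusion t v)).range := by
    refine PushoutI.mem_range_base_of_commute (Γ.endpointInclusion_injective t v)
      (x := fun i => ⟨Γ.σ (endpoint t v (!i)), Γ.σ_mem_specialSubgroup_iff.2 (hne i)⟩) ?_ fun i => ?_
    · rintro i ⟨⟨c, hc⟩, hci⟩
      have hc' : c = Γ.σ (endpoint t v (!i)) := congrArg Subtype.val hci
      rw [hc', σ_mem_specialSubgroup_iff] at hc
      refine hc ?_
      cases i <;> simp [endpoint]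
    · rw [← Γ.amalgamGen_eq htv i (hne i), ← Γ.liftHom_σ (Γ.amalgamGen htv)]
      refine Commute.map ?_ (Γ.toAmalgam htv hm)
      cases i
      · exact ht
      · exact hv
  obtain ⟨c, hc⟩ := hz
  rw [← Γ.ofAmalgam_toAmalgam htv hm z, ← hc, ofAmalgam, PushoutI.lift_base]
  exact c.2

theorem map_inclHom_specialSubgroup (K : Set V) (L : Set K) :
    ((Γ.induce K).specialSubgroup L).map (Γ.inclHom K) = Γ.specialSubgroup (Subtype.val '' L) := by
  rw [specialSubgroup, specialSubgroup, MonoidHom.map_closure, Set.image_image, Set.image_image]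
  congr 2

/-- A central element lying in the special subgroup of `X` lies in that of `X \ {t}`, whenever `t`
is not a cone point. -/
theorem mem_specialSubgroup_diff_singleton_of_mem_center {z : Γ.ArtinGroup}
    (hz : z ∈ Subgroup.center Γ.ArtinGroup) {X : Set V} (hX : z ∈ Γ.specialSubgroup X) {t v : V}
    (ht : t ∈ X) (htv : t ≠ v) (hm : Γ.m t v = ⊤) : z ∈ Γ.specialSubgroup (X \ {t}) := by
  have hY := Γ.specialSubgroup_mono (Set.subset_insert v X) hX
  rw [← range_inclHom] at hY
  obtain ⟨z, rfl⟩ := hY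
  have hcomm (g) : Commute z g := by
    apply Γ.inclHom_injective
    rw [map_mul, map_mul]
    exact (Subgroup.mem_center_iff.1 hz _).symm
  have hmem := (Γ.induce (insert v X)).mem_specialSubgroup_of_commute
    (t := ⟨t, Set.mem_insert_of_mem v ht⟩) (v := ⟨v, Set.mem_insert v X⟩)
    (fun h => htv (congrArg Subtype.val h)) hm (hcomm _) (hcomm _)
  have hmap := Subgroup.mem_map_of_mem (Γ.inclHom (insert v X)) hmem
  rw [map_inclHom_specialSubgroup] at hmap
  refine Γ.specialSubgroup_mono ?_ hmap
  rintro _ ⟨⟨u, hu⟩, hu', rfl⟩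
  simp only [Set.mem_compl_iff, Set.mem_insert_iff, Subtype.mk.injEq, Set.mem_singleton_iff,
    not_or] at hu'
  exact ⟨hu.resolve_left hu'.2, hu'.1⟩

end LabelledGraph

/-- If `Γ` has no cone points, i.e. for every vertex `t` there is a
vertex `v ≠ t` with `m t v = ∞`, then the Artin group `A_Γ` has trivial center. -/
theorem center_eq_bot_of_no_conePoints {V : Type*} [Finite V] (Γ : LabelledGraph V)
    (h : ∀ t : V, ∃ v : V, v ≠ t ∧ Γ.m t v = ⊤) :
    Subgroup.center Γ.ArtinGroup = ⊥ := by
  rw [eq_bot_iff]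
  intro z hz
  have huniv : z ∈ Γ.specialSubgroup Set.univ := by
    rw [LabelledGraph.specialSubgroup, Set.image_univ, Γ.closure_range_σ]
    trivial
  obtain ⟨X, hX, hmin⟩ := wellFounded_lt.has_min {X : Set V | z ∈ Γ.specialSubgroup X}
    ⟨Set.univ, huniv⟩
  rcases X.eq_empty_or_nonempty with rfl | ⟨t, ht⟩
  · simpa [LabelledGraph.specialSubgroup] using hX
  · obtain ⟨v, hvt, hm⟩ := h t
    exact absurd (Set.sdiff_singleton_ssubset.2 ht) (hmin (X \ {t})
      (Γ.mem_specialSubgroup_diff_singleton_of_mem_center hz hX ht hvt.symm hm))
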